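/- (Comparison principle) Let Ω ⊆ ℝⁿ be bounded, u, v ∈ C²(Ω) ∩ C(Ω̄) spacelike in Ω, with u k-admissible. Let ψ(x,z) ∈ C¹(Ω̄ × ℝ) be positive with ψ_z ≥ 0. If u ≤ v on ∂Ω and σ_k[u] ≥ ψ(x,u), σ_k[v] ≤ ψ(x,v) in Ω, then u ≤ v in Ω. -/

import Mathlib

/-- The gradient vector Du of a function on Euclidean space. -/
noncomputable def grad (n : ℕ) (u : EuclideanSpace ℝ (Fin n) → ℝ)
    (x : EuclideanSpace ℝ (Fin n)) (i : Fin n) : ℝ :=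
  fderiv ℝ u x (EuclideanSpace.single i 1)

/-- The Hessian matrix D²u of a function on Euclidean space. -/
noncomputable def hess (n : ℕ) (u : EuclideanSpace ℝ (Fin n) → ℝ)
    (x : EuclideanSpace ℝ (Fin n)) (i j : Fin n) : ℝ :=
  fderiv ℝ (fun y => fderiv ℝ u y (EuclideanSpace.single j 1)) x (EuclideanSpace.single i 1)

/-- The symmetric curvature matrix a = (1/w) γ D²u γ of the graph of u in Minkowski
    space, whose eigenvalues are the principal curvatures. -/
noncomputable def curvMatrix (n : ℕ) (u : EuclideanSpace ℝ (Fin n) → ℝ)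
    (x : EuclideanSpace ℝ (Fin n)) : Matrix (Fin n) (Fin n) ℝ :=
  let p : Fin n → ℝ := grad n u x
  let w : ℝ := Real.sqrt (1 - ∑ i, p i ^ 2)
  let γ : Matrix (Fin n) (Fin n) ℝ :=
    Matrix.of fun i k => (if i = k then (1 : ℝ) else 0) + p i * p k / (w * (1 + w))
  w⁻¹ • (γ * Matrix.of (hess n u x) * γ)

/-- σ_k of the eigenvalues of a matrix, via the characteristic polynomial. -/
noncomputable def sigmaMat (n k : ℕ) (M : Matrix (Fin n) (Fin n) ℝ) : ℝ :=
  (-1 : ℝ) ^ k * M.charpoly.coeff (n - k)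

/-- σ_k of the principal curvatures of the graph of u at x. -/
noncomputable def sigmaK (n k : ℕ) (u : EuclideanSpace ℝ (Fin n) → ℝ)
    (x : EuclideanSpace ℝ (Fin n)) : ℝ :=
  sigmaMat n k (curvMatrix n u x)

open Polynomial

theorem splits_deriv_real {p : ℝ[X]} (hp : p.Splits) : (derivative p).Splits := by
  by_cases h0 : p.natDegree = 0
  · rw [natDegree_eq_zero] at h0
    obtain ⟨c, rfl⟩ := h0
    simp
  · rw [splits_iff_card_roots] at hp ⊢
    have h1 := card_roots_le_derivative p
    have h2 := (derivative p).card_roots'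
    have h3 := natDegree_derivative_lt h0
    omega

theorem splits_iter_deriv_real {p : ℝ[X]} (hp : p.Splits) (m : ℕ) :
    (derivative^[m] p).Splits := by
  induction m with
  | zero => simpa using hp
  | succ m ih => rw [Function.iterate_succ_apply']; exact splits_deriv_real ih

theorem laguerre_prod (s : Multiset ℝ) (c t : ℝ) :
    (C c * (s.map (fun a => X - C a)).prod).eval t *
      (derivative (derivative (C c * (s.map (fun a => X - C a)).prod))).eval t ≤
    ((derivative (C c * (s.map (fun a => X - C a)).prod)).eval t) ^ 2 := by
  induction s using Multiset.induction_on with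
  | empty => simp
  | cons a s ih =>
    have e : C c * ((a ::ₘ s).map (fun a => X - C a)).prod =
      (X - C a) * (C c * (s.map (fun a => X - C a)).prod) := by
      simp; ring
    rw [e]
    generalize C c * (s.map (fun a => X - C a)).prod = R at ih
    simp only [derivative_mul, eval_mul, eval_add, derivative_add, eval_sub, eval_X, eval_C,
      derivative_sub, derivative_X, derivative_C, sub_zero, one_mul]
    nlinarith [sq_nonneg (R.eval t), mul_le_mul_of_nonneg_left ih (sq_nonneg (t - a))]

theorem laguerre_real {p : ℝ[X]} (hp : p.Splits) (t : ℝ) :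
    p.eval t * (derivative (derivative p)).eval t ≤ ((derivative p).eval t) ^ 2 := by
  rw [hp.eq_prod_roots]
  exact laguerre_prod _ _ _

theorem newton_coeff {p : ℝ[X]} (hp : p.Splits) (m : ℕ) :
    p.coeff m * p.coeff (m + 2) ≤ p.coeff (m + 1) ^ 2 := by
  have h := laguerre_real (splits_iter_deriv_real hp m) 0
  rw [← Function.iterate_succ_apply' derivative, ← Function.iterate_succ_apply' derivative] at h
  simp only [← coeff_zero_eq_eval_zero, coeff_iterate_derivative, zero_add, Nat.descFactorial_self,
    nsmul_eq_mul, Nat.succ_eq_add_one, Nat.factorial_succ, Nat.cast_mul] at h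
  have hf : (0 : ℝ) < (m.factorial : ℝ) := by positivity
  push_cast at h
  rcases le_or_gt (p.coeff m * p.coeff (m + 2)) 0 with h1 | h1
  · exact h1.trans (sq_nonneg _)
  have hm : (0 : ℝ) ≤ m := by positivity
  set a := p.coeff m
  set b := p.coeff (m + 1)
  set c := p.coeff (m + 2)
  have h2 : (m + 1 + 1) * (a * c) ≤ (m + 1 : ℝ) * b ^ 2 := by
    have h3 : 0 < (m.factorial : ℝ) ^ 2 * (m + 1) := by positivity
    refine le_of_mul_le_mul_left ?_ h3
    nlinarith [h]
  nlinarith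

theorem esymm_cons' (s : Multiset ℝ) (a : ℝ) (k : ℕ) :
    (a ::ₘ s).esymm (k + 1) = s.esymm (k + 1) + a * s.esymm k := by
  simp [Multiset.esymm, Multiset.powersetCard_cons, Multiset.map_map, Multiset.sum_map_mul_left]

theorem newton_esymm (s : Multiset ℝ) (m : ℕ) :
    s.esymm m * s.esymm (m + 2) ≤ s.esymm (m + 1) ^ 2 := by
  by_cases hm : m + 2 ≤ s.card
  · have hp : ((s.map fun r => X + C r).prod).Splits :=
      Splits.multisetProd (by
        intro f hf
        obtain ⟨a, -, rfl⟩ := Multiset.mem_map.1 hf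
        exact Splits.X_add_C a)
    have := newton_coeff hp (s.card - (m + 2))
    rw [Multiset.prod_X_add_C_coeff s (by omega), Multiset.prod_X_add_C_coeff s (by omega),
      Multiset.prod_X_add_C_coeff s (by omega)] at this
    rw [show s.card - (s.card - (m + 2)) = m + 2 by omega,
      show s.card - (s.card - (m + 2) + 2) = m by omega,
      show s.card - (s.card - (m + 2) + 1) = m + 1 by omega] at this
    linarith
  · have : s.esymm (m + 2) = 0 := by
      simp [Multiset.esymm, Multiset.powersetCard_eq_empty _ (not_le.1 hm)]
    rw [this]; simp; positivity

theorem garding_esymm (s : Multiset ℝ) (a : ℝ) (k : ℕ)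
    (h : ∀ j, 1 ≤ j → j ≤ k + 1 → 0 < (a ::ₘ s).esymm j) : 0 < s.esymm k := by
  induction k with
  | zero => simp [Multiset.esymm]
  | succ k ih =>
    have h0 := ih (fun j h1 h2 => h j h1 (by omega))
    have h1 := h (k + 1) (by omega) (by omega)
    have h2 := h (k + 2) (by omega) (by omega)
    rw [esymm_cons'] at h1 h2
    have hN := newton_esymm s k
    by_contra! hc
    have ha : 0 < a := by
      by_contra! h4
      nlinarith [mul_nonneg (neg_nonneg.2 h4) h0.le]
    nlinarith [mul_pos h2 h0, mul_nonneg (neg_nonneg.2 hc) h1.le]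

theorem charpoly_diag_rank_one (n : ℕ) (d q : Fin n → ℝ) (t : ℝ) :
    (Matrix.diagonal d + t • Matrix.vecMulVec q q).charpoly =
      ∏ i, (X - C (d i)) -
        C t * ∑ i, C (q i ^ 2) * ∏ j ∈ Finset.univ.erase i, (X - C (d j)) := by
  refine Polynomial.eq_of_infinite_eval_eq _ _ ?_
  have hinf : (Set.range d)ᶜ.Infinite := (Set.finite_range d).infinite_compl
  refine hinf.mono ?_
  intro x hx
  have hne : ∀ i, x - d i ≠ 0 := by
    intro i h
    exact hx ⟨i, by linarith⟩
  show Polynomial.eval _ _ = _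
  rw [Matrix.eval_charpoly]
  have e : Matrix.scalar (Fin n) x - (Matrix.diagonal d + t • Matrix.vecMulVec q q) =
      Matrix.diagonal (fun i => x - d i) *
        (1 + Matrix.replicateCol Unit (fun i => (x - d i)⁻¹ * (-t * q i)) *
          Matrix.replicateRow Unit q) := by
    ext i j
    rw [Matrix.diagonal_mul]
    have := hne i
    simp [Matrix.mul_apply, Matrix.vecMulVec_apply, Matrix.one_apply, Matrix.diagonal_apply]
    split_ifs <;> field_simp <;> ring
  rw [e, Matrix.det_mul, Matrix.det_diagonal, Matrix.det_one_add_replicateCol_mul_replicateRow]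
  simp only [eval_sub, eval_prod, eval_X, eval_C, eval_mul, eval_finsetSum, dotProduct]
  rw [mul_add, mul_one, sub_eq_add_neg, Finset.mul_sum, Finset.mul_sum, ← Finset.sum_neg_distrib]
  congr 1
  refine Finset.sum_congr rfl fun i _ => ?_
  rw [← Finset.mul_prod_erase Finset.univ _ (Finset.mem_univ i)]
  have := hne i
  field_simp

theorem sigmaMat_diag_rank_one (n k : ℕ) (hk : 1 ≤ k) (hkn : k ≤ n) (d q : Fin n → ℝ) (t : ℝ) :
    sigmaMat n k (Matrix.diagonal d + t • Matrix.vecMulVec q q) =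
      (Finset.univ.val.map d).esymm k +
        t * ∑ i, q i ^ 2 * ((Finset.univ.erase i).val.map d).esymm (k - 1) := by
  have h1 : (∏ i, (X - C (d i))).coeff (n - k) = (-1) ^ k * (Finset.univ.val.map d).esymm k := by
    have := Multiset.prod_X_sub_C_coeff (Finset.univ.val.map d) (k := n - k) (by simp)
    rw [Multiset.map_map] at this
    simp only [Multiset.card_map, Finset.card_val, Finset.card_univ, Fintype.card_fin] at this
    rw [show n - (n - k) = k by omega] at this
    exact this
  have h2 : ∀ i, (∏ j ∈ Finset.univ.erase i, (X - C (d j))).coeff (n - k) =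
      (-1) ^ (k - 1) * ((Finset.univ.erase i).val.map d).esymm (k - 1) := by
    intro i
    have hc : (Multiset.map d (Finset.univ.erase i).val).card = n - 1 := by
      rw [Multiset.card_map, Finset.card_val, Finset.card_erase_of_mem (Finset.mem_univ i)]
      simp
    have := Multiset.prod_X_sub_C_coeff ((Finset.univ.erase i).val.map d) (k := n - k)
      (by rw [hc]; omega)
    rw [Multiset.map_map, hc] at this
    rw [show n - 1 - (n - k) = k - 1 by omega] at this
    exact this
  rw [sigmaMat, charpoly_diag_rank_one, coeff_sub, coeff_C_mul, finsetSum_coeff, h1]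
  simp only [coeff_C_mul, h2]
  obtain ⟨m, rfl⟩ := Nat.exists_eq_add_of_le' hk
  simp only [Nat.add_sub_cancel]
  have hs : ((-1 : ℝ) ^ m) * (-1) ^ m = 1 := by rw [← mul_pow]; simp
  have : ∑ i, q i ^ 2 * ((-1) ^ m * ((Finset.univ.erase i).val.map d).esymm m) =
      (-1) ^ m * ∑ i, q i ^ 2 * ((Finset.univ.erase i).val.map d).esymm m := by
    rw [Finset.mul_sum]; refine Finset.sum_congr rfl fun i _ => by ring
  rw [this, pow_succ]
  linear_combination ((Finset.univ.val.map d).esymm (m + 1) +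
    t * ∑ i, q i ^ 2 * ((Finset.univ.erase i).val.map d).esymm m) * hs

/-- membership in the Gårding cone -/
def Gam (n k : ℕ) (A : Matrix (Fin n) (Fin n) ℝ) : Prop :=
  ∀ j, 1 ≤ j → j ≤ k → 0 < sigmaMat n j A

theorem rank_one_diag (n k : ℕ) (hk : 1 ≤ k) (hkn : k ≤ n) (d q : Fin n → ℝ)
    (hA : Gam n k (Matrix.diagonal d)) :
    ∃ S : ℝ, 0 ≤ S ∧ (q ≠ 0 → 0 < S) ∧ ∀ t : ℝ,
      sigmaMat n k (Matrix.diagonal d + t • Matrix.vecMulVec q q) =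
        sigmaMat n k (Matrix.diagonal d) + t * S := by
  have h0 : ∀ j, 1 ≤ j → j ≤ k →
      sigmaMat n j (Matrix.diagonal d) = (Finset.univ.val.map d).esymm j := by
    intro j h1 h2
    have := sigmaMat_diag_rank_one n j h1 (h2.trans hkn) d 0 0
    simpa using this
  have hpos : ∀ i, 0 < ((Finset.univ.erase i).val.map d).esymm (k - 1) := by
    intro i
    apply garding_esymm _ (d i)
    intro j h1 h2
    have h3 := hA j h1 (by omega)
    rw [h0 j h1 (by omega)] at h3
    convert h3 using 2
    rw [← Multiset.map_cons]
    congr 1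
    rw [Finset.erase_val]
    exact Multiset.cons_erase (Finset.mem_univ_val i)
  refine ⟨∑ i, q i ^ 2 * ((Finset.univ.erase i).val.map d).esymm (k - 1), ?_, ?_, ?_⟩
  · exact Finset.sum_nonneg fun i _ => mul_nonneg (sq_nonneg _) (hpos i).le
  · intro hq
    obtain ⟨i, hi⟩ := Function.ne_iff.1 hq
    refine Finset.sum_pos' (fun i _ => mul_nonneg (sq_nonneg _) (hpos i).le)
      ⟨i, Finset.mem_univ i, mul_pos (by simpa using pow_pos (abs_pos.2 hi) 2) (hpos i)⟩
  · intro t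
    rw [h0 k hk le_rfl]
    exact sigmaMat_diag_rank_one n k hk hkn d q t

theorem sigmaMat_conj (n k : ℕ) (U V M : Matrix (Fin n) (Fin n) ℝ) (h : V * U = 1) :
    sigmaMat n k (U * M * V) = sigmaMat n k M := by
  rw [sigmaMat, Matrix.charpoly_mul_comm, ← mul_assoc, h, one_mul, sigmaMat]

theorem rank_one_symm (n k : ℕ) (hk : 1 ≤ k) (hkn : k ≤ n) (A : Matrix (Fin n) (Fin n) ℝ)
    (hAs : A.IsHermitian) (hA : Gam n k A) (q : Fin n → ℝ) :
    ∃ S : ℝ, 0 ≤ S ∧ (q ≠ 0 → 0 < S) ∧ ∀ t : ℝ,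
      sigmaMat n k (A + t • Matrix.vecMulVec q q) = sigmaMat n k A + t * S := by
  obtain ⟨U, V, d, hVU, hUV, hT, hd⟩ : ∃ (U V : Matrix (Fin n) (Fin n) ℝ) (d : Fin n → ℝ),
      V * U = 1 ∧ U * V = 1 ∧ V = U.transpose ∧ A = U * Matrix.diagonal d * V := by
    refine ⟨hAs.eigenvectorUnitary, star (hAs.eigenvectorUnitary : Matrix (Fin n) (Fin n) ℝ),
      hAs.eigenvalues, ?_, ?_, ?_, ?_⟩
    · exact Unitary.coe_star_mul_self _
    · exact Unitary.coe_mul_star_self _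
    · rw [Matrix.star_eq_conjTranspose, Matrix.conjTranspose_eq_transpose_of_trivial]
    · have := hAs.spectral_theorem
      rw [Unitary.conjStarAlgAut_apply] at this
      exact this
  have hq : Matrix.vecMulVec q q =
      U * Matrix.vecMulVec (V.mulVec q) (V.mulVec q) * V := by
    rw [Matrix.mul_vecMulVec, Matrix.vecMulVec_mul, Matrix.mulVec_mulVec, hUV, Matrix.one_mulVec]
    congr 1
    conv_rhs => rw [hT, ← Matrix.mulVec_transpose, Matrix.transpose_transpose, ← hT,
      Matrix.mulVec_mulVec, hUV, Matrix.one_mulVec]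
  have hsum : ∀ t : ℝ, A + t • Matrix.vecMulVec q q =
      U * (Matrix.diagonal d + t • Matrix.vecMulVec (V.mulVec q) (V.mulVec q)) * V := by
    intro t
    rw [hq, mul_add, add_mul, ← hd, Matrix.mul_smul, Matrix.smul_mul]
  have hG : Gam n k (Matrix.diagonal d) := by
    intro j h1 h2
    have := hA j h1 h2
    rwa [hd, sigmaMat_conj _ _ _ _ _ hVU] at this
  obtain ⟨S, h1, h2, h3⟩ := rank_one_diag n k hk hkn d (V.mulVec q) hG
  refine ⟨S, h1, ?_, ?_⟩
  · intro hq0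
    apply h2
    intro h
    apply hq0
    have : U.mulVec (V.mulVec q) = 0 := by rw [h, Matrix.mulVec_zero]
    rwa [Matrix.mulVec_mulVec, hUV, Matrix.one_mulVec] at this
  · intro t
    rw [hsum, sigmaMat_conj _ _ _ _ _ hVU, h3, hd, sigmaMat_conj _ _ _ _ _ hVU]

theorem vecMulVec_herm (n : ℕ) (q : Fin n → ℝ) (t : ℝ) :
    (t • Matrix.vecMulVec q q).IsHermitian := by
  ext i j
  simp [Matrix.vecMulVec_apply, mul_comm]

theorem Gam_rank_one (n k : ℕ) (hkn : k ≤ n) (A : Matrix (Fin n) (Fin n) ℝ)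
    (hAs : A.IsHermitian) (hA : Gam n k A) (q : Fin n → ℝ) (t : ℝ) (ht : 0 ≤ t) :
    Gam n k (A + t • Matrix.vecMulVec q q) := by
  intro j h1 h2
  obtain ⟨S, hS, -, h3⟩ := rank_one_symm n j h1 (h2.trans hkn) A hAs
    (fun i hi hi' => hA i hi (hi'.trans h2)) q
  rw [h3]
  have := hA j h1 h2
  positivity

open scoped MatrixOrder in
theorem psd_decomp (n : ℕ) (A : Matrix (Fin n) (Fin n) ℝ) (hA : A.PosSemidef) :
    ∃ M : Matrix (Fin n) (Fin n) ℝ, A = M.conjTranspose * M :=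
  CStarAlgebra.nonneg_iff_eq_star_mul_self.mp hA.nonneg

theorem sigmaMat_mono (n k : ℕ) (hk : 1 ≤ k) (hkn : k ≤ n) (A B : Matrix (Fin n) (Fin n) ℝ)
    (hAs : A.IsHermitian) (hA : Gam n k A) (hB : (B - A).PosSemidef) :
    sigmaMat n k A ≤ sigmaMat n k B := by
  obtain ⟨M, hM⟩ := psd_decomp n _ hB
  have e : B = A + ∑ i, Matrix.vecMulVec (M i) (M i) := by
    rw [← sub_eq_iff_eq_add', hM]
    ext i j
    simp [Matrix.mul_apply, Matrix.sum_apply, Matrix.vecMulVec_apply]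
  have key : ∀ s : Finset (Fin n), (A + ∑ i ∈ s, Matrix.vecMulVec (M i) (M i)).IsHermitian ∧
      Gam n k (A + ∑ i ∈ s, Matrix.vecMulVec (M i) (M i)) ∧
      sigmaMat n k A ≤ sigmaMat n k (A + ∑ i ∈ s, Matrix.vecMulVec (M i) (M i)) := by
    intro s
    induction s using Finset.induction_on with
    | empty => simpa using ⟨hAs, hA⟩
    | insert a s ha ih =>
      obtain ⟨i1, i2, i3⟩ := ih
      have e1 : A + ∑ i ∈ insert a s, Matrix.vecMulVec (M i) (M i) =
          (A + ∑ i ∈ s, Matrix.vecMulVec (M i) (M i)) +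
            (1 : ℝ) • Matrix.vecMulVec (M a) (M a) := by
        rw [Finset.sum_insert ha, one_smul]; abel
      rw [e1]
      refine ⟨i1.add (vecMulVec_herm n _ _), Gam_rank_one n k hkn _ i1 i2 _ _ zero_le_one, ?_⟩
      obtain ⟨S, hS, -, h3⟩ := rank_one_symm n k hk hkn _ i1 i2 (M a)
      rw [h3]
      linarith
  rw [e]
  exact (key Finset.univ).2.2

theorem contDiff_mvPoly {ι : Type*} [Fintype ι] (p : MvPolynomial ι ℝ) :
    ContDiff ℝ 1 (fun x : ι → ℝ => MvPolynomial.eval x p) := by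
  induction p using MvPolynomial.induction_on with
  | C a => simpa using contDiff_const
  | add p q hp hq => simpa using hp.add hq
  | mul_X p i hp => simpa using hp.mul (contDiff_apply ℝ ℝ i)

theorem contDiff_sigmaMat (n k : ℕ) :
    ContDiff ℝ 1 (fun x : Fin n × Fin n → ℝ =>
      sigmaMat n k (Matrix.of fun i j => x (i, j))) := by
  have h := contDiff_mvPoly ((Matrix.charpoly.univ ℝ (Fin n)).coeff (n - k))
  have : (fun x : Fin n × Fin n → ℝ => sigmaMat n k (Matrix.of fun i j => x (i, j))) =
      fun x => (-1 : ℝ) ^ k *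
        MvPolynomial.eval x ((Matrix.charpoly.univ ℝ (Fin n)).coeff (n - k)) := by
    funext x
    have := Matrix.charpoly.univ_coeff_eval₂Hom (Fin n) (RingHom.id ℝ) x (n - k)
    rw [sigmaMat]
    congr 1
    exact this.symm
  rw [this]
  exact contDiff_const.mul h

/-- the matrix γ -/
noncomputable def gmat (n : ℕ) (p : Fin n → ℝ) : Matrix (Fin n) (Fin n) ℝ :=
  Matrix.of fun i k => (if i = k then (1 : ℝ) else 0) +
    p i * p k / (Real.sqrt (1 - ∑ i, p i ^ 2) * (1 + Real.sqrt (1 - ∑ i, p i ^ 2)))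

/-- curvature matrix as a function of gradient and hessian -/
noncomputable def cm (n : ℕ) (p : Fin n → ℝ) (H : Fin n → Fin n → ℝ) :
    Matrix (Fin n) (Fin n) ℝ :=
  (Real.sqrt (1 - ∑ i, p i ^ 2))⁻¹ • (gmat n p * Matrix.of H * gmat n p)

theorem sigmaK_eq (n k : ℕ) (u : EuclideanSpace ℝ (Fin n) → ℝ)
    (x : EuclideanSpace ℝ (Fin n)) :
    sigmaK n k u x = sigmaMat n k (cm n (grad n u x) (hess n u x)) := rfl

theorem gmat_transpose (n : ℕ) (p : Fin n → ℝ) : (gmat n p).transpose = gmat n p := by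
  ext i j
  simp [gmat, eq_comm, mul_comm]

theorem cm_herm (n : ℕ) (p : Fin n → ℝ) (H : Fin n → Fin n → ℝ)
    (hH : ∀ i j, H i j = H j i) : (cm n p H).IsHermitian := by
  rw [Matrix.IsHermitian, Matrix.conjTranspose_eq_transpose_of_trivial, cm,
    Matrix.transpose_smul, Matrix.transpose_mul, Matrix.transpose_mul, gmat_transpose, mul_assoc]
  congr 3
  ext i j
  exact hH j i

theorem cm_psd (n : ℕ) (p : Fin n → ℝ) (H H' : Fin n → Fin n → ℝ)
    (h : (Matrix.of H' - Matrix.of H).PosSemidef) : (cm n p H' - cm n p H).PosSemidef := by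
  have e : cm n p H' - cm n p H = (Real.sqrt (1 - ∑ i, p i ^ 2))⁻¹ •
      (gmat n p * (Matrix.of H' - Matrix.of H) * (gmat n p).conjTranspose) := by
    rw [Matrix.conjTranspose_eq_transpose_of_trivial, gmat_transpose, mul_sub, sub_mul, smul_sub]
    rfl
  rw [e]
  exact (h.mul_mul_conjTranspose_same _).smul (by positivity)

/-- matrix unit -/
def EE (n : ℕ) (i0 : Fin n) : Fin n → Fin n → ℝ :=
  fun i j => (Pi.single i0 1 : Fin n → ℝ) i * (Pi.single i0 1 : Fin n → ℝ) j

theorem cm_rank_one (n : ℕ) (i0 : Fin n) (p : Fin n → ℝ) (H : Fin n → Fin n → ℝ) (t : ℝ) :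
    cm n p (H + t • EE n i0) = cm n p H + (t * (Real.sqrt (1 - ∑ i, p i ^ 2))⁻¹) •
      Matrix.vecMulVec ((gmat n p).mulVec (Pi.single i0 1))
        ((gmat n p).mulVec (Pi.single i0 1)) := by
  have e : Matrix.of (H + t • EE n i0) =
      Matrix.of H + t • Matrix.vecMulVec (Pi.single i0 1) (Pi.single i0 1) := by
    ext i j
    simp [EE, Matrix.vecMulVec_apply]
  have e2 : Matrix.vecMulVec ((gmat n p).mulVec (Pi.single i0 1))
        ((gmat n p).mulVec (Pi.single i0 1)) =
      gmat n p * Matrix.vecMulVec (Pi.single i0 1) (Pi.single i0 1) * gmat n p := by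
    rw [Matrix.mul_vecMulVec, Matrix.vecMulVec_mul, ← Matrix.mulVec_transpose, gmat_transpose]
  rw [e2, cm, cm, e, mul_add, add_mul, smul_add, Matrix.mul_smul, Matrix.smul_mul, smul_smul,
    mul_comm t]

theorem gmat_ne (n : ℕ) (i0 : Fin n) (p : Fin n → ℝ) :
    (gmat n p).mulVec (Pi.single i0 1) ≠ 0 := by
  intro h
  have := congrFun h i0
  simp only [Matrix.mulVec_single_one, Matrix.col_apply, gmat, Matrix.of_apply, if_true,
    Pi.zero_apply] at this
  have h2 : 0 ≤ p i0 * p i0 /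
      (Real.sqrt (1 - ∑ i, p i ^ 2) * (1 + Real.sqrt (1 - ∑ i, p i ^ 2))) :=
    div_nonneg (mul_self_nonneg _) (by positivity)
  linarith

/-- affine behaviour of `F` along the rank-one direction -/
theorem F_affine (n k : ℕ) (hk : 1 ≤ k) (hkn : k ≤ n) (i0 : Fin n)
    (p : Fin n → ℝ) (H : Fin n → Fin n → ℝ) (hp : ∑ i, p i ^ 2 < 1)
    (hH : ∀ i j, H i j = H j i) (hG : Gam n k (cm n p H)) :
    ∃ T : ℝ, 0 < T ∧ ∀ t : ℝ, sigmaMat n k (cm n p (H + t • EE n i0)) =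
      sigmaMat n k (cm n p H) + t * T := by
  obtain ⟨S, h1, h2, h3⟩ := rank_one_symm n k hk hkn _ (cm_herm n p H hH) hG
    ((gmat n p).mulVec (Pi.single i0 1))
  refine ⟨(Real.sqrt (1 - ∑ i, p i ^ 2))⁻¹ * S, ?_, ?_⟩
  · have := h2 (gmat_ne n i0 p)
    have : 0 < Real.sqrt (1 - ∑ i, p i ^ 2) := Real.sqrt_pos.2 (by linarith)
    positivity
  · intro t
    rw [cm_rank_one, h3]; ring

theorem Gam_EE (n k : ℕ) (hkn : k ≤ n) (i0 : Fin n)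
    (p : Fin n → ℝ) (H : Fin n → Fin n → ℝ)
    (hH : ∀ i j, H i j = H j i) (hG : Gam n k (cm n p H)) (t : ℝ) (ht : 0 ≤ t) :
    Gam n k (cm n p (H + t • EE n i0)) := by
  rw [cm_rank_one]
  exact Gam_rank_one n k hkn _ (cm_herm n p H hH) hG _ _ (by positivity)

theorem cm_contDiffAt (n : ℕ) (z : (Fin n → ℝ) × (Fin n → Fin n → ℝ))
    (hz : ∑ i, z.1 i ^ 2 < 1) :
    ContDiffAt ℝ 1 (fun (z : (Fin n → ℝ) × (Fin n → Fin n → ℝ)) (q : Fin n × Fin n) =>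
      cm n z.1 z.2 q.1 q.2) z := by
  have hp : ∀ i, ContDiffAt ℝ 1
      (fun z : (Fin n → ℝ) × (Fin n → Fin n → ℝ) => z.1 i) z := fun i => by fun_prop
  have hH : ∀ i j, ContDiffAt ℝ 1
      (fun z : (Fin n → ℝ) × (Fin n → Fin n → ℝ) => z.2 i j) z := fun i j => by fun_prop
  have hw : ContDiffAt ℝ 1
      (fun z : (Fin n → ℝ) × (Fin n → Fin n → ℝ) => Real.sqrt (1 - ∑ i, z.1 i ^ 2)) z := by
    refine ContDiffAt.sqrt ?_ (by linarith)
    exact contDiffAt_const.sub (ContDiffAt.sum fun i _ => (hp i).pow 2)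
  have hwp : 0 < Real.sqrt (1 - ∑ i, z.1 i ^ 2) := Real.sqrt_pos.2 (by linarith)
  have hg : ∀ i j, ContDiffAt ℝ 1
      (fun z : (Fin n → ℝ) × (Fin n → Fin n → ℝ) => gmat n z.1 i j) z := by
    intro i j
    simp only [gmat, Matrix.of_apply]
    refine contDiffAt_const.add (((hp i).mul (hp j)).div (hw.mul (contDiffAt_const.add hw)) ?_)
    positivity
  rw [contDiffAt_pi]
  intro q
  have e : (fun z : (Fin n → ℝ) × (Fin n → Fin n → ℝ) => cm n z.1 z.2 q.1 q.2) =
      fun z => (Real.sqrt (1 - ∑ i, z.1 i ^ 2))⁻¹ *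
        ∑ j, (∑ i, gmat n z.1 q.1 i * z.2 i j) * gmat n z.1 j q.2 := by
    funext z
    simp only [cm, Matrix.smul_apply, Matrix.mul_apply, smul_eq_mul, Matrix.of_apply]
  rw [e]
  refine (hw.inv hwp.ne').mul (ContDiffAt.sum fun i _ => ContDiffAt.mul
      (ContDiffAt.sum fun j _ => (hg _ _).mul (hH _ _)) (hg _ _))

theorem F_contDiffAt (n k : ℕ) (z : (Fin n → ℝ) × (Fin n → Fin n → ℝ))
    (hz : ∑ i, z.1 i ^ 2 < 1) :
    ContDiffAt ℝ 1 (fun z : (Fin n → ℝ) × (Fin n → Fin n → ℝ) =>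
      sigmaMat n k (cm n z.1 z.2)) z := by
  have h := (contDiff_sigmaMat n k).contDiffAt.comp z (cm_contDiffAt n z hz)
  have e : (fun z : (Fin n → ℝ) × (Fin n → Fin n → ℝ) => sigmaMat n k (cm n z.1 z.2)) =
      (fun x : Fin n × Fin n → ℝ => sigmaMat n k (Matrix.of fun i j => x (i, j))) ∘
      (fun (z : (Fin n → ℝ) × (Fin n → Fin n → ℝ)) (q : Fin n × Fin n) =>
      cm n z.1 z.2 q.1 q.2) := by
    funext z
    rfl
  rw [e]
  exact h

open Filter Topology in
theorem local_strict (n k : ℕ) (hk : 1 ≤ k) (hkn : k ≤ n) (i0 : Fin n)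
    (z0 : (Fin n → ℝ) × (Fin n → Fin n → ℝ)) (hsp : ∑ i, z0.1 i ^ 2 < 1)
    (hH : ∀ i j, z0.2 i j = z0.2 j i) (hG : Gam n k (cm n z0.1 z0.2)) :
    ∃ N0 : ℝ, ∃ s0 > 0, ∀ᶠ z in 𝓝 z0, (∀ i j, z.2 i j = z.2 j i) →
      ∀ s, 0 < s → s < s0 → ∀ N, 1 ≤ N → N0 ≤ N →
        Gam n k (cm n (z.1 + s • Pi.single i0 1) (z.2 + (N * s) • EE n i0)) ∧
        sigmaMat n k (cm n z.1 z.2) <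
          sigmaMat n k (cm n (z.1 + s • Pi.single i0 1) (z.2 + (N * s) • EE n i0)) := by
  set F : ℕ → (Fin n → ℝ) × (Fin n → Fin n → ℝ) → ℝ :=
    fun j z => sigmaMat n j (cm n z.1 z.2) with hF
  have hcont : ∀ j, ContinuousAt (F j) z0 := fun j => (F_contDiffAt n j z0 hsp).continuousAt
  obtain ⟨T0, hT0, hT0'⟩ := F_affine n k hk hkn i0 _ _ hsp hH hG
  have hTc : ContinuousAt (fun z => F k (z.1, z.2 + EE n i0) - F k z) z0 := by
    refine ContinuousAt.sub ?_ (hcont k)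
    have h1 : ContinuousAt (F k) (z0.1, z0.2 + EE n i0) :=
      (F_contDiffAt n k (z0.1, z0.2 + EE n i0) hsp).continuousAt
    exact ContinuousAt.comp (f := fun z : (Fin n → ℝ) × (Fin n → Fin n → ℝ) =>
      (z.1, z.2 + EE n i0)) h1 (by fun_prop)
  have hTz : F k (z0.1, z0.2 + EE n i0) - F k z0 = T0 := by
    have := hT0' 1
    simp only [one_smul, one_mul] at this
    simp only [hF, this]; ring
  have e1 : ∀ᶠ z in 𝓝 z0, T0 / 2 < F k (z.1, z.2 + EE n i0) - F k z :=
    hTc.eventually (lt_mem_nhds (show T0 / 2 < F k (z0.1, z0.2 + EE n i0) - F k z0 by rw [hTz]; linarith))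
  have e2 : ∀ᶠ z in 𝓝 z0, ∀ j ∈ Finset.Icc 1 k, 0 < F j z := by
    rw [Filter.eventually_all_finset]
    intro j hj
    rw [Finset.mem_Icc] at hj
    exact (hcont j).eventually (lt_mem_nhds (hG j hj.1 hj.2))
  have e3 : ∀ᶠ z in 𝓝 z0, ∑ i, z.1 i ^ 2 < 1 := by
    have : ContinuousAt (fun z : (Fin n → ℝ) × (Fin n → Fin n → ℝ) => ∑ i, z.1 i ^ 2) z0 := by
      fun_prop
    exact this.eventually (gt_mem_nhds hsp)
  obtain ⟨K, U, hU, hK⟩ := (F_contDiffAt n k z0 hsp).exists_lipschitzOnWith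
  have e5 : Tendsto (fun y : ((Fin n → ℝ) × (Fin n → Fin n → ℝ)) × ℝ =>
      (y.1.1 + y.2 • (Pi.single i0 1 : Fin n → ℝ), y.1.2)) (𝓝 (z0, 0)) (𝓝 z0) := by
    have : Continuous (fun y : ((Fin n → ℝ) × (Fin n → Fin n → ℝ)) × ℝ =>
      (y.1.1 + y.2 • (Pi.single i0 1 : Fin n → ℝ), y.1.2)) := by fun_prop
    have := this.tendsto (z0, 0)
    simpa using this
  have e6 := e5.eventually (e1.and (e2.and (e3.and hU)))
  rw [nhds_prod_eq, Filter.eventually_prod_iff] at e6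
  obtain ⟨pa, ha, pb, hb, hab⟩ := e6
  obtain ⟨s0, hs0, hs0'⟩ := Metric.eventually_nhds_iff.1 hb
  set L : ℝ := K * ‖(Pi.single i0 1 : Fin n → ℝ)‖ with hL
  have hL0 : 0 ≤ L := by positivity
  refine ⟨(L + 1) / (T0 / 2), s0, hs0, ?_⟩
  filter_upwards [ha, hU] with z hz hzU hzs s hs hss N hN1 hN
  obtain ⟨f1, f2, f3, f4⟩ := hab hz (hs0' (y := s) (by simpa [abs_of_pos hs] using hss))
  have hG' : Gam n k (cm n (z.1 + s • Pi.single i0 1) z.2) :=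
    fun j h1 h2 => f2 j (Finset.mem_Icc.2 ⟨h1, h2⟩)
  refine ⟨Gam_EE n k hkn i0 _ _ hzs hG' _ (by positivity), ?_⟩
  obtain ⟨T, hT, hT'⟩ := F_affine n k hk hkn i0 _ _ f3 hzs hG'
  have hTT : T0 / 2 < T := by
    have := hT' 1
    simp only [one_smul, one_mul] at this
    simp only [hF, this] at f1
    linarith
  have hlip := hK.dist_le_mul _ f4 _ hzU
  have hd : dist (z.1 + s • (Pi.single i0 1 : Fin n → ℝ), z.2) z ≤
      s * ‖(Pi.single i0 1 : Fin n → ℝ)‖ := by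
    rw [Prod.dist_eq]
    simp only [dist_self, dist_eq_norm, add_sub_cancel_left, norm_smul, Real.norm_eq_abs,
      abs_of_pos hs]
    exact max_le le_rfl (by positivity)
  have hlip2 : F k z - L * s ≤ sigmaMat n k (cm n (z.1 + s • Pi.single i0 1) z.2) := by
    have h3 := hlip.trans (mul_le_mul_of_nonneg_left hd K.2)
    rw [Real.dist_eq] at h3
    have h4 := (abs_le.1 h3).1
    simp only [hF]
    have : (K : ℝ) * (s * ‖(Pi.single i0 1 : Fin n → ℝ)‖) = L * s := by rw [hL]; ring
    have h5 : (K : ℝ) * (s * ‖(Pi.single i0 1 : Fin n → ℝ)‖) =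
      K.1 * (s * ‖(Pi.single i0 1 : Fin n → ℝ)‖) := rfl
    linarith
  rw [hT']
  have h6 : L + 1 ≤ N * (T0 / 2) := by
    rwa [div_le_iff₀ (by positivity)] at hN
  have h7 : N * (T0 / 2) ≤ N * T := mul_le_mul_of_nonneg_left hTT.le (by linarith)
  have h8 : s * (L + 1) ≤ s * (N * T) := mul_le_mul_of_nonneg_left (h6.trans h7) hs.le
  simp only [hF] at hlip2
  nlinarith

section Analysis
open Filter Topology

theorem hess_eq {n : ℕ} {u : EuclideanSpace ℝ (Fin n) → ℝ} {x : EuclideanSpace ℝ (Fin n)}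
    (hu : ContDiffAt ℝ 2 u x) (i j : Fin n) :
    hess n u x i j = fderiv ℝ (fderiv ℝ u) x (EuclideanSpace.single i 1)
      (EuclideanSpace.single j 1) := by
  have hd : DifferentiableAt ℝ (fderiv ℝ u) x :=
    (hu.fderiv_right (m := 1) (by norm_num)).differentiableAt (by norm_num)
  have := (hd.hasFDerivAt.clm_apply
    (hasFDerivAt_const (EuclideanSpace.single j (1 : ℝ)) x)).fderiv
  rw [hess, this]
  simp

theorem hess_symm {n : ℕ} {u : EuclideanSpace ℝ (Fin n) → ℝ} {x : EuclideanSpace ℝ (Fin n)}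
    (hu : ContDiffAt ℝ 2 u x) (i j : Fin n) : hess n u x i j = hess n u x j i := by
  rw [hess_eq hu, hess_eq hu]
  exact (hu.isSymmSndFDerivAt (by simp)).eq _ _

theorem jet_continuousAt {n : ℕ} {u : EuclideanSpace ℝ (Fin n) → ℝ}
    {x : EuclideanSpace ℝ (Fin n)} (hu : ContDiffAt ℝ 2 u x) :
    ContinuousAt (fun x => (grad n u x, hess n u x)) x := by
  have h1 : ContDiffAt ℝ 1 (fderiv ℝ u) x := hu.fderiv_right (m := 1) (by norm_num)
  have h2 : ContinuousAt (fderiv ℝ (fderiv ℝ u)) x :=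
    (h1.fderiv_right (m := 0) (by norm_num)).continuousAt
  refine ContinuousAt.prodMk ?_ ?_
  · rw [continuousAt_pi]
    intro i
    exact h1.continuousAt.clm_apply continuousAt_const
  · rw [continuousAt_pi]
    intro i
    rw [continuousAt_pi]
    intro j
    have h3 : ContinuousAt (fun x => fderiv ℝ (fderiv ℝ u) x (EuclideanSpace.single i 1)
      (EuclideanSpace.single j 1)) x :=
      (h2.clm_apply continuousAt_const).clm_apply continuousAt_const
    refine h3.congr ?_
    filter_upwards [hu.eventually (by simp)] with y hy
    exact (hess_eq hy i j).symm

theorem second_deriv_max {E : Type*} [NormedAddCommGroup E] [NormedSpace ℝ E]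
    {g : E → ℝ} {y : E} (hg : ContDiffAt ℝ 2 g y) (hm : IsLocalMax g y) (ξ : E) :
    fderiv ℝ (fderiv ℝ g) y ξ ξ ≤ 0 := by
  by_contra! hpos
  set l : ℝ → E := fun t => y + t • ξ with hl
  have hl0 : l 0 = y := by simp [hl]
  have hld : ∀ t, HasDerivAt l ξ t := by
    intro t
    have := ((hasDerivAt_id t).smul_const ξ).const_add y
    rw [one_smul] at this
    exact this
  have hlc : Tendsto l (𝓝 0) (𝓝 y) := by
    have := (hld 0).continuousAt.tendsto
    rwa [hl0] at this
  have hd1 : ∀ᶠ t in 𝓝 (0 : ℝ), deriv (g ∘ l) t = fderiv ℝ g (l t) ξ := by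
    filter_upwards [hlc.eventually (hg.eventually (by simp))] with t ht
    exact ((ht.differentiableAt (by norm_num)).hasFDerivAt.comp_hasDerivAt t (hld t)).deriv
  have h1 : DifferentiableAt ℝ (fderiv ℝ g) (l 0) := by
    rw [hl0]
    exact (hg.fderiv_right (m := 1) (by norm_num)).differentiableAt (by norm_num)
  have hd2 : deriv (deriv (g ∘ l)) 0 = fderiv ℝ (fderiv ℝ g) y ξ ξ := by
    rw [Filter.EventuallyEq.deriv_eq hd1]
    have := (h1.hasFDerivAt.comp_hasDerivAt 0 (hld 0)).clm_apply (hasDerivAt_const (0 : ℝ) ξ)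
    rw [hl0] at this
    simpa using this.deriv
  have hmax : IsLocalMax (g ∘ l) 0 := by
    have := hlc.eventually hm
    filter_upwards [this] with t ht
    simpa [hl0] using ht
  have hmin : IsLocalMin (g ∘ l) 0 := by
    refine isLocalMin_of_deriv_deriv_pos (by rw [hd2]; exact hpos) hmax.deriv_eq_zero ?_
    have hc : ContinuousAt g (l 0) := by rw [hl0]; exact hg.continuousAt
    exact ContinuousAt.comp hc (hld 0).continuousAt
  have hconst : (g ∘ l) =ᶠ[𝓝 0] fun _ => (g ∘ l) 0 := by
    filter_upwards [hmax, hmin] with t h1 h2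
    exact le_antisymm h1 h2
  have : deriv (deriv (g ∘ l)) 0 = 0 := by
    rw [hconst.deriv.deriv_eq]
    simp
  linarith

theorem touch {n : ℕ} {u v : EuclideanSpace ℝ (Fin n) → ℝ} {y : EuclideanSpace ℝ (Fin n)}
    (hu : ContDiffAt ℝ 2 u y) (hv : ContDiffAt ℝ 2 v y) (i0 : Fin n) (ε N : ℝ)
    (hm : IsLocalMax (fun x : EuclideanSpace ℝ (Fin n) =>
      u x + ε * Real.exp (N * x i0) - v x) y) :
    grad n v y = grad n u y + (ε * N * Real.exp (N * y i0)) • Pi.single i0 1 ∧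
    (Matrix.of (hess n v y) - Matrix.of (hess n u y +
      (N * (ε * N * Real.exp (N * y i0))) • EE n i0)).PosSemidef := by
  set P : EuclideanSpace ℝ (Fin n) →L[ℝ] ℝ := EuclideanSpace.proj i0 with hP
  have hPa : ∀ x, P x = x i0 := fun x => rfl
  have hexp : ∀ x, HasFDerivAt (fun x : EuclideanSpace ℝ (Fin n) => Real.exp (N * x i0))
      ((N * Real.exp (N * x i0)) • P) x := by
    intro x
    have := ((P.hasFDerivAt (x := x)).const_mul N).exp
    rw [smul_smul] at this
    rw [mul_comm N]
    exact this
  have hgC : ContDiffAt ℝ 2 (fun x : EuclideanSpace ℝ (Fin n) =>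
      u x + ε * Real.exp (N * x i0) - v x) y := by
    have : ContDiff ℝ 2 (fun x : EuclideanSpace ℝ (Fin n) => ε * Real.exp (N * x i0)) :=
      contDiff_const.mul ((contDiff_const.mul P.contDiff).exp)
    exact (hu.add this.contDiffAt).sub hv
  have hd1 : fderiv ℝ (fun x : EuclideanSpace ℝ (Fin n) =>
      u x + ε * Real.exp (N * x i0) - v x) =ᶠ[𝓝 y]
      fun x => fderiv ℝ u x + ((ε * N) * Real.exp (N * x i0)) • P - fderiv ℝ v x := by
    filter_upwards [hu.eventually (by simp), hv.eventually (by simp)] with x hx hx'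
    have := (((hx.differentiableAt (by norm_num)).hasFDerivAt.add
      ((hexp x).const_mul ε)).sub (hx'.differentiableAt (by norm_num)).hasFDerivAt).fderiv
    rw [smul_smul, ← mul_assoc] at this
    exact this
  have hdu : DifferentiableAt ℝ (fderiv ℝ u) y :=
    (hu.fderiv_right (m := 1) (by norm_num)).differentiableAt (by norm_num)
  have hdv : DifferentiableAt ℝ (fderiv ℝ v) y :=
    (hv.fderiv_right (m := 1) (by norm_num)).differentiableAt (by norm_num)
  have hd2 : fderiv ℝ (fderiv ℝ (fun x : EuclideanSpace ℝ (Fin n) =>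
      u x + ε * Real.exp (N * x i0) - v x)) y =
      fderiv ℝ (fderiv ℝ u) y +
      (((ε * N) • ((N * Real.exp (N * y i0)) • P)).smulRight P) - fderiv ℝ (fderiv ℝ v) y := by
    rw [hd1.fderiv_eq]
    exact ((hdu.hasFDerivAt.add (((hexp y).const_mul (ε * N)).smul_const P)).sub
      hdv.hasFDerivAt).fderiv
  have hz : fderiv ℝ u y + ((ε * N) * Real.exp (N * y i0)) • P - fderiv ℝ v y = 0 := by
    rw [← hd1.eq_of_nhds]
    exact hm.fderiv_eq_zero
  constructor
  · funext i
    have := congrArg (fun L : EuclideanSpace ℝ (Fin n) →L[ℝ] ℝ =>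
      L (EuclideanSpace.single i 1)) hz
    simp only [ContinuousLinearMap.sub_apply, ContinuousLinearMap.add_apply,
      ContinuousLinearMap.smul_apply, hPa, smul_eq_mul, ContinuousLinearMap.zero_apply] at this
    simp only [grad, Pi.add_apply, Pi.smul_apply, smul_eq_mul]
    have e : (EuclideanSpace.single i (1 : ℝ) : EuclideanSpace ℝ (Fin n)) i0 =
        (Pi.single i0 1 : Fin n → ℝ) i := by
      simp [Pi.single_apply, eq_comm]
    rw [e] at this
    linarith
  · refine Matrix.PosSemidef.of_dotProduct_mulVec_nonneg ?_ ?_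
    · ext i j
      simp [hess_symm hu i j, hess_symm hv i j, EE, mul_comm]
    · intro ξ
      set X : EuclideanSpace ℝ (Fin n) := ∑ i, ξ i • EuclideanSpace.single i 1 with hX
      have h2 := second_deriv_max hgC hm X
      rw [hd2] at h2
      have hquad : ∀ B : EuclideanSpace ℝ (Fin n) →L[ℝ] EuclideanSpace ℝ (Fin n) →L[ℝ] ℝ,
          B X X = ∑ i, ∑ j, ξ i * ξ j *
            B (EuclideanSpace.single i 1) (EuclideanSpace.single j 1) := by
        intro B
        simp only [hX, map_sum, map_smul, ContinuousLinearMap.sum_apply,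
          ContinuousLinearMap.smul_apply, smul_eq_mul, Finset.mul_sum]
        rw [Finset.sum_comm]
        refine Finset.sum_congr rfl fun i _ => Finset.sum_congr rfl fun j _ => by ring
      rw [hquad] at h2
      have e : ∀ i, (EuclideanSpace.single i (1 : ℝ) : EuclideanSpace ℝ (Fin n)) i0 =
          (Pi.single i0 1 : Fin n → ℝ) i := by
        intro i
        simp [Pi.single_apply, eq_comm]
      have h3 : star ξ ⬝ᵥ ((Matrix.of (hess n v y) - Matrix.of (hess n u y +
          (N * (ε * N * Real.exp (N * y i0))) • EE n i0)).mulVec ξ) =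
          - ∑ i, ∑ j, ξ i * ξ j * ((fderiv ℝ (fderiv ℝ u) y +
            (((ε * N) • ((N * Real.exp (N * y i0)) • P)).smulRight P) -
              fderiv ℝ (fderiv ℝ v) y) (EuclideanSpace.single i 1)
                (EuclideanSpace.single j 1)) := by
        rw [← Finset.sum_neg_distrib]
        simp only [dotProduct, Matrix.mulVec, Finset.mul_sum, ← Finset.sum_neg_distrib]
        refine Finset.sum_congr rfl fun i _ => Finset.sum_congr rfl fun j _ => ?_
        simp only [Matrix.sub_apply, Matrix.of_apply, Pi.add_apply, Pi.smul_apply, smul_eq_mul,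
          ContinuousLinearMap.sub_apply, ContinuousLinearMap.add_apply,
          ContinuousLinearMap.smulRight_apply, ContinuousLinearMap.smul_apply, hPa, e, EE,
          hess_eq hu, hess_eq hv, Pi.star_apply, star_trivial]
        ring
      rw [h3]
      linarith

end Analysis


/-- Strict inequality for the perturbed jets of u at x. -/
def StrictAt (n k : ℕ) (i0 : Fin n) (N0 s0 : ℝ) (p : Fin n → ℝ) (H : Fin n → Fin n → ℝ) : Prop :=
  ∀ s, 0 < s → s < s0 → ∀ N, 1 ≤ N → N0 ≤ N →
    Gam n k (cm n (p + s • Pi.single i0 1) (H + (N * s) • EE n i0)) ∧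
    sigmaMat n k (cm n p H) <
      sigmaMat n k (cm n (p + s • Pi.single i0 1) (H + (N * s) • EE n i0))

theorem compact_strict (n k : ℕ) (hk : 1 ≤ k) (hkn : k ≤ n) (i0 : Fin n)
    (Ω K : Set (EuclideanSpace ℝ (Fin n))) (hΩ : IsOpen Ω) (hKc : IsCompact K) (hKΩ : K ⊆ Ω)
    (u : EuclideanSpace ℝ (Fin n) → ℝ) (huA : ∀ x ∈ Ω, ContDiffAt ℝ 2 u x)
    (huspace : ∀ x ∈ Ω, ∑ i, grad n u x i ^ 2 < 1)
    (huadm : ∀ x ∈ Ω, ∀ j, 1 ≤ j → j ≤ k → 0 < sigmaK n j u x) :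
    ∃ N0 : ℝ, ∃ s0 > 0, ∀ x ∈ K, StrictAt n k i0 N0 s0 (grad n u x) (hess n u x) := by
  refine hKc.induction_on (p := fun K' => ∃ N0 : ℝ, ∃ s0 > 0, ∀ x ∈ K',
    StrictAt n k i0 N0 s0 (grad n u x) (hess n u x)) ?_ ?_ ?_ ?_
  · exact ⟨0, 1, one_pos, fun x hx => hx.elim⟩
  · rintro s t hst ⟨N0, s0, h0, h⟩
    exact ⟨N0, s0, h0, fun x hx => h x (hst hx)⟩
  · rintro s t ⟨N0, s0, h0, h⟩ ⟨N1, s1, h1, h'⟩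
    refine ⟨max N0 N1, min s0 s1, lt_min h0 h1, ?_⟩
    rintro x (hx | hx) s hs hss N hN hN'
    · exact h x hx s hs (hss.trans_le (min_le_left _ _)) N hN ((le_max_left _ _).trans hN')
    · exact h' x hx s hs (hss.trans_le (min_le_right _ _)) N hN ((le_max_right _ _).trans hN')
  · intro x hx
    have hxΩ := hKΩ hx
    have hG : Gam n k (cm n (grad n u x) (hess n u x)) := by
      intro j h1 h2
      rw [← sigmaK_eq]
      exact huadm x hxΩ j h1 h2
    obtain ⟨N0, s0, h0, h⟩ := local_strict n k hk hkn i0 (grad n u x, hess n u x)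
      (huspace x hxΩ) (hess_symm (huA x hxΩ)) hG
    have h2 := (hΩ.eventually_mem hxΩ).and ((jet_continuousAt (huA x hxΩ)).eventually h)
    obtain ⟨t, ht, htP⟩ := Filter.eventually_iff_exists_mem.1 h2
    exact ⟨t, mem_nhdsWithin_of_mem_nhds ht, N0, s0, h0,
      fun y hy => (htP y hy).2 (hess_symm (huA y (htP y hy).1))⟩

/-- Comparison principle: if u is k-admissible, v spacelike, ψ > 0 with ψ_z ≥ 0,
    u ≤ v on ∂Ω, σ_k[u] ≥ ψ(x,u) and σ_k[v] ≤ ψ(x,v) in Ω, then u ≤ v in Ω. -/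
theorem stmt13 {n k : ℕ} (hk : 1 ≤ k) (hkn : k ≤ n)
    (Ω : Set (EuclideanSpace ℝ (Fin n))) (hΩ : IsOpen Ω)
    (hbd : Bornology.IsBounded Ω)
    (u v : EuclideanSpace ℝ (Fin n) → ℝ)
    (hu : ContDiffOn ℝ 2 u Ω) (hv : ContDiffOn ℝ 2 v Ω)
    (huc : ContinuousOn u (closure Ω)) (hvc : ContinuousOn v (closure Ω))
    (huspace : ∀ x ∈ Ω, ∑ i, grad n u x i ^ 2 < 1)
    (hvspace : ∀ x ∈ Ω, ∑ i, grad n v x i ^ 2 < 1)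
    (huadm : ∀ x ∈ Ω, ∀ j, 1 ≤ j → j ≤ k → 0 < sigmaK n j u x)
    (ψ : EuclideanSpace ℝ (Fin n) → ℝ → ℝ)
    (hψC1 : ContDiff ℝ 1 fun p : EuclideanSpace ℝ (Fin n) × ℝ => ψ p.1 p.2)
    (hψpos : ∀ x z, 0 < ψ x z)
    (hψz : ∀ x, Monotone fun z => ψ x z)
    (hbdry : ∀ x ∈ frontier Ω, u x ≤ v x)
    (hsub : ∀ x ∈ Ω, ψ x (u x) ≤ sigmaK n k u x)
    (hsup : ∀ x ∈ Ω, sigmaK n k v x ≤ ψ x (v x)) :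
    ∀ x ∈ Ω, u x ≤ v x := by
  intro x₀ hx₀
  by_contra! hlt
  have huA : ∀ x ∈ Ω, ContDiffAt ℝ 2 u x := fun x hx => hu.contDiffAt (hΩ.mem_nhds hx)
  have hvA : ∀ x ∈ Ω, ContDiffAt ℝ 2 v x := fun x hx => hv.contDiffAt (hΩ.mem_nhds hx)
  have hcpt : IsCompact (closure Ω) := hbd.isCompact_closure
  set i0 : Fin n := ⟨0, by omega⟩ with hi0
  set M : ℝ := u x₀ - v x₀ with hM
  have hMpos : 0 < M := by rw [hM]; linarith
  set K : Set (EuclideanSpace ℝ (Fin n)) := {x | x ∈ closure Ω ∧ M / 2 ≤ u x - v x} with hK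
  have hKΩ : K ⊆ Ω := by
    rintro x ⟨hx, hx'⟩
    by_contra hn
    have hf : x ∈ frontier Ω := by
      rw [frontier, hΩ.interior_eq]
      exact ⟨hx, hn⟩
    have := hbdry x hf
    linarith
  have hKc : IsCompact K := by
    refine hcpt.of_isClosed_subset ?_ (fun x hx => hx.1)
    have := (huc.sub hvc).preimage_isClosed_of_isClosed isClosed_closure
      (isClosed_Ici (a := M / 2))
    exact this
  have hloc := compact_strict n k hk hkn i0 Ω K hΩ hKc hKΩ u huA huspace huadm
  obtain ⟨N0, s0, hs0, hstrict⟩ := hloc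
  set N : ℝ := max 1 N0 with hN
  have hN1 : 1 ≤ N := le_max_left _ _
  have hexpc : Continuous fun x : EuclideanSpace ℝ (Fin n) => Real.exp (N * x i0) := by
    fun_prop
  obtain ⟨C, hC⟩ := hcpt.bddAbove_image hexpc.continuousOn
  have hCx : ∀ x ∈ closure Ω, Real.exp (N * x i0) ≤ C := fun x hx => hC ⟨x, hx, rfl⟩
  have hx₀c : x₀ ∈ closure Ω := subset_closure hx₀
  have hCpos : 0 < C := (Real.exp_pos _).trans_le (hCx x₀ hx₀c)
  obtain ⟨ε, hε, hε1, hε2⟩ : ∃ ε : ℝ, 0 < ε ∧ ε * C < M / 2 ∧ ε * N * C < s0 := by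
    have hNpos : 0 < N := by linarith
    refine ⟨min (M / 4 / C) (s0 / 2 / (N * C)), by positivity, ?_, ?_⟩
    · calc min (M / 4 / C) (s0 / 2 / (N * C)) * C ≤ M / 4 / C * C :=
            mul_le_mul_of_nonneg_right (min_le_left _ _) hCpos.le
        _ = M / 4 := by field_simp
        _ < M / 2 := by linarith
    · calc min (M / 4 / C) (s0 / 2 / (N * C)) * N * C
            = min (M / 4 / C) (s0 / 2 / (N * C)) * (N * C) := by ring
        _ ≤ s0 / 2 / (N * C) * (N * C) :=
            mul_le_mul_of_nonneg_right (min_le_right _ _) (by positivity)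
        _ = s0 / 2 := by field_simp
        _ < s0 := by linarith
  obtain ⟨y, hyc, hymax⟩ := hcpt.exists_isMaxOn ⟨x₀, hx₀c⟩
    (f := fun x : EuclideanSpace ℝ (Fin n) => u x + ε * Real.exp (N * x i0) - v x)
    ((huc.add (continuousOn_const.mul hexpc.continuousOn)).sub hvc)
  have hyK : y ∈ K := by
    refine ⟨hyc, ?_⟩
    have h1 : u x₀ + ε * Real.exp (N * x₀ i0) - v x₀ ≤
      u y + ε * Real.exp (N * y i0) - v y := hymax hx₀c
    have h2 : ε * Real.exp (N * y i0) ≤ ε * C := mul_le_mul_of_nonneg_left (hCx y hyc) hε.le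
    have h3 : 0 < ε * Real.exp (N * x₀ i0) := by positivity
    linarith
  have hyΩ := hKΩ hyK
  have hlm : IsLocalMax (fun x : EuclideanSpace ℝ (Fin n) =>
      u x + ε * Real.exp (N * x i0) - v x) y :=
    hymax.isLocalMax (Filter.mem_of_superset (hΩ.mem_nhds hyΩ) subset_closure)
  obtain ⟨hgr, hps⟩ := touch (huA y hyΩ) (hvA y hyΩ) i0 ε N hlm
  obtain ⟨hG, hlt'⟩ := hstrict y hyK (ε * N * Real.exp (N * y i0)) (by positivity)
    ((mul_le_mul_of_nonneg_left (hCx y hyc) (by positivity)).trans_lt hε2) N hN1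
    (le_max_right _ _)
  rw [← hgr] at hG hlt'
  have hsym : ∀ i j, (hess n u y + (N * (ε * N * Real.exp (N * y i0))) • EE n i0) i j =
      (hess n u y + (N * (ε * N * Real.exp (N * y i0))) • EE n i0) j i := by
    intro i j
    simp only [Pi.add_apply, Pi.smul_apply, EE, hess_symm (huA y hyΩ) i j, smul_eq_mul]
    ring
  have hmono := sigmaMat_mono n k hk hkn _ _ (cm_herm n _ _ hsym) hG
    (cm_psd n (grad n v y) _ _ hps)
  have h1 := hsub y hyΩ
  have h2 := hsup y hyΩ
  rw [sigmaK_eq] at h1 h2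
  have h3 : ψ y (v y) ≤ ψ y (u y) := hψz y (by have := hyK.2; linarith)
  linarith
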